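/- arXiv:1003.3576 — 3 statements merged into one kernel-verified Lean document; each statement's English description precedes it below -/
import Mathlib

section
/- For every ε > 0 there exists p₀ such that for every prime p > p₀ and every primitive root g modulo p, every residue class modulo p can be written as g^x − g^y (mod p) with integers x, y satisfying 0 ≤ x, y < (√2 + ε)·p^{3/4}; that is, {g^x − g^y mod p : 0 ≤ x, y < (√2 + ε)p^{3/4}} = F_p. -/
open Finset in
lemma line_card (p : ℕ) [Fact p.Prime] (a : ZMod p) (q : ZMod p × ZMod p) (hq : q.1 ≠ 0) :
    #{z : ZMod p × ZMod p | q.1 * z.1 - q.2 * z.2 = a} = p := by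
  have h : #(univ : Finset (ZMod p)) = #{z : ZMod p × ZMod p | q.1 * z.1 - q.2 * z.2 = a} := by
    refine Finset.card_bij (fun t _ => ((a + q.2 * t) / q.1, t)) ?_ ?_ ?_
    · intro t _
      simp only [mem_filter, mem_univ, true_and]
      field_simp
      ring
    · intro t _ t' _ h
      exact (Prod.mk.inj h).2
    · rintro ⟨s, t⟩ h
      simp only [mem_filter, mem_univ, true_and] at h
      refine ⟨t, mem_univ _, ?_⟩
      ext
      · simp only
        field_simp
        linear_combination -h
      · rfl
  rw [← h, Finset.card_univ, ZMod.card]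

open Finset in
lemma line_inter (p : ℕ) [Fact p.Prime] (a : ZMod p) (ha : a ≠ 0) (q q' : ZMod p × ZMod p)
    (hne : q ≠ q') :
    #{z : ZMod p × ZMod p | q.1 * z.1 - q.2 * z.2 = a ∧ q'.1 * z.1 - q'.2 * z.2 = a} ≤ 1 := by
  rw [Finset.card_le_one]
  rintro ⟨s, t⟩ h ⟨s', t'⟩ h'
  obtain ⟨u, v⟩ := q
  obtain ⟨u', v'⟩ := q'
  simp only [mem_filter, mem_univ, true_and] at h h'
  obtain ⟨h1, h2⟩ := h
  obtain ⟨h3, h4⟩ := h'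
  by_cases hd : u * v' - u' * v = 0
  · exfalso
    apply hne
    have e1 : a * (u' - u) = 0 := by linear_combination (-u') * h1 + u * h2 + t * hd
    have e2 : a * (v' - v) = 0 := by linear_combination (-v') * h1 + v * h2 + s * hd
    have e3 := (mul_eq_zero.1 e1).resolve_left ha
    have e4 := (mul_eq_zero.1 e2).resolve_left ha
    rw [sub_eq_zero.1 e3, sub_eq_zero.1 e4]
  · have e1 : (u * v' - u' * v) * (s - s') = 0 := by
      linear_combination v' * (h1 - h3) - v * (h2 - h4)
    have e2 : (u * v' - u' * v) * (t - t') = 0 := by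
      linear_combination u' * (h1 - h3) - u * (h2 - h4)
    have e3 := (mul_eq_zero.1 e1).resolve_left hd
    have e4 := (mul_eq_zero.1 e2).resolve_left hd
    rw [sub_eq_zero.1 e3, sub_eq_zero.1 e4]

open Finset in
lemma exists_pair (p : ℕ) [Fact p.Prime] (a : ZMod p) (ha : a ≠ 0)
    (Q : Finset (ZMod p × ZMod p)) (hQ : ∀ q ∈ Q, q.1 ≠ 0) (hcard : p ^ 3 < #Q ^ 2) :
    ∃ q ∈ Q, ∃ z ∈ Q, q.1 * z.1 - q.2 * z.2 = a := by
  by_contra! hno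
  set f : ZMod p × ZMod p → ZMod p × ZMod p → ℤ :=
    fun q z => if q.1 * z.1 - q.2 * z.2 = a then 1 else 0 with hf
  set r : ZMod p × ZMod p → ℤ := fun z => ∑ q ∈ Q, f q z with hr
  have h1 : ∑ z, r z = p * #Q := by
    simp only [hr]
    rw [sum_comm]
    have : ∀ q ∈ Q, ∑ z, f q z = p := by
      intro q hq
      simp only [hf]
      rw [Finset.sum_boole, line_card p a q (hQ q hq)]
    rw [sum_congr rfl this]
    simp [mul_comm]
  have h2 : ∑ z, r z ^ 2 ≤ p * #Q + #Q ^ 2 := by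
    have e : ∑ z, r z ^ 2 = ∑ q ∈ Q, ∑ q' ∈ Q, ∑ z, f q z * f q' z := by
      simp only [hr, pow_two, sum_mul_sum]
      rw [sum_comm]
      refine sum_congr rfl fun q _ => ?_
      rw [sum_comm]
    have b : ∀ q ∈ Q, ∀ q' ∈ Q, ∑ z, f q z * f q' z ≤ (if q = q' then (p : ℤ) else 0) + 1 := by
      intro q hq q' hq'
      have e2 : ∑ z, f q z * f q' z =
          #{z : ZMod p × ZMod p | q.1 * z.1 - q.2 * z.2 = a ∧ q'.1 * z.1 - q'.2 * z.2 = a} := by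
        rw [← Finset.sum_boole]
        refine sum_congr rfl fun z _ => ?_
        simp only [hf]
        split_ifs <;> simp_all
      rw [e2]
      split_ifs with h
      · subst h
        simp only [and_self]
        rw [line_card p a q (hQ q hq)]
        linarith
      · have := line_inter p a ha q q' h
        rw [zero_add]
        exact_mod_cast this
    rw [e]
    calc _ ≤ ∑ q ∈ Q, ∑ q' ∈ Q, ((if q = q' then (p : ℤ) else 0) + 1) :=
          sum_le_sum fun q hq => sum_le_sum fun q' hq' => b q hq q' hq'
      _ = _ := by
          simp only [sum_add_distrib, sum_ite_eq]
          rw [sum_congr rfl (fun q hq => if_pos hq)]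
          simp
          ring
  have h3 : ∑ z, ((p : ℤ) * r z - #Q) ^ 2 ≤ p ^ 3 * #Q := by
    have e : ∑ z, ((p : ℤ) * r z - #Q) ^ 2 =
        p ^ 2 * ∑ z, r z ^ 2 - 2 * p * #Q * ∑ z, r z + p ^ 2 * #Q ^ 2 := by
      have e3 : ∑ _z : ZMod p × ZMod p, (#Q : ℤ) ^ 2 = p ^ 2 * #Q ^ 2 := by
        rw [sum_const, Finset.card_univ, Fintype.card_prod, ZMod.card, nsmul_eq_mul]
        push_cast
        ring
      rw [← e3, mul_sum, mul_sum, ← sum_sub_distrib, ← sum_add_distrib]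
      refine sum_congr rfl fun z _ => ?_
      ring
    rw [e, h1]
    have := mul_le_mul_of_nonneg_left h2 (sq_nonneg (p : ℤ))
    nlinarith
  have h4 : (#Q : ℤ) * #Q ^ 2 ≤ ∑ z, ((p : ℤ) * r z - #Q) ^ 2 := by
    have e : ∑ z ∈ Q, ((p : ℤ) * r z - #Q) ^ 2 = (#Q : ℤ) * #Q ^ 2 := by
      have : ∀ z ∈ Q, ((p : ℤ) * r z - #Q) ^ 2 = #Q ^ 2 := by
        intro z hz
        have : r z = 0 := sum_eq_zero fun q hq => if_neg (hno q hq z hz)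
        rw [this]
        ring
      rw [sum_congr rfl this]
      simp
    rw [← e]
    exact sum_le_sum_of_subset_of_nonneg (subset_univ _) fun _ _ _ => sq_nonneg _
  have hc : (p : ℤ) ^ 3 < #Q ^ 2 := by exact_mod_cast hcard
  have hpos : (0 : ℤ) < #Q := by
    rcases Nat.eq_zero_or_pos (#Q) with h | h
    · rw [h] at hcard
      simp at hcard
    · exact_mod_cast h
  nlinarith

open Finset in
lemma cover_aux (p : ℕ) [Fact p.Prime] (hp2 : 2 < p) (g : (ZMod p)ˣ) (hg : orderOf g = p - 1)
    (M : ℕ) (hM : 2 * M ≤ p - 1) (hM4 : p ^ 3 < 4 * M ^ 4) (c : ZMod p) (hc : c ≠ 0) :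
    ∃ x y : ℕ, x + 2 ≤ 2 * M ∧ y + 2 ≤ 2 * M ∧
      ((g ^ x : (ZMod p)ˣ) : ZMod p) - ((g ^ y : (ZMod p)ˣ) : ZMod p) = c := by
  haveI : Fact (2 < p) := ⟨hp2⟩
  have hne : (1 : ZMod p) ≠ -1 := (ZMod.neg_one_ne_one).symm
  set S : Finset (ZMod p) := {1, -1} with hS
  have hS2 : ∀ σ ∈ S, σ ^ 2 = 1 := by
    intro σ hσ
    simp only [hS, mem_insert, mem_singleton] at hσ
    rcases hσ with rfl | rfl <;> ring
  set φ : ZMod p × ℕ × ℕ → ZMod p × ZMod p :=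
    fun w => (w.1 * ((g ^ w.2.1 : (ZMod p)ˣ) : ZMod p), w.1 * ((g ^ w.2.2 : (ZMod p)ˣ) : ZMod p))
    with hφ
  have key : ∀ σ ∈ S, ∀ τ ∈ S, ∀ x < M, ∀ y < M,
      σ * ((g ^ x : (ZMod p)ˣ) : ZMod p) = τ * ((g ^ y : (ZMod p)ˣ) : ZMod p) → x = y := by
    intro σ hσ τ hτ x hx y hy h
    have h2 : (g ^ (2 * x) : (ZMod p)ˣ) = g ^ (2 * y) := by
      apply Units.ext
      have := congrArg (· ^ 2) h
      simp only [mul_pow, hS2 σ hσ, hS2 τ hτ, one_mul] at this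
      push_cast at this ⊢
      rw [mul_comm 2 x, mul_comm 2 y, pow_mul, pow_mul, this]
    have := pow_injOn_Iio_orderOf (x := g) (by simp [hg]; omega) (by simp [hg]; omega) h2
    omega
  set D : Finset (ZMod p × ℕ × ℕ) := S ×ˢ (range M ×ˢ range M) with hD
  have hinj : Set.InjOn φ D := by
    rintro ⟨σ, x, y⟩ hw ⟨τ, x', y'⟩ hw' h
    simp only [hD, coe_product, Set.mem_prod, mem_coe, mem_range] at hw hw'
    obtain ⟨k1, k2⟩ := Prod.mk.inj h
    simp only at k1 k2
    have ex := key σ hw.1 τ hw'.1 x hw.2.1 x' hw'.2.1 k1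
    have ey := key σ hw.1 τ hw'.1 y hw.2.2 y' hw'.2.2 k2
    subst ex ey
    have := mul_right_cancel₀ (Units.ne_zero _) k1
    rw [this]
  have hcard : #(D.image φ) = 2 * M ^ 2 := by
    rw [card_image_of_injOn hinj, hD, card_product, card_product, hS, card_pair hne, card_range]
    ring
  obtain ⟨q, hq, z, hz, hqz⟩ := exists_pair p c hc (D.image φ) (by
    intro q hq
    obtain ⟨⟨σ, x, y⟩, hw, rfl⟩ := mem_image.1 hq
    simp only [hD, mem_product] at hw
    have h0 : σ ≠ 0 := by
      rintro rfl
      have := hS2 0 hw.1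
      simp at this
    exact mul_ne_zero h0 (Units.ne_zero _)) (by
    rw [hcard]
    calc p ^ 3 < 4 * M ^ 4 := hM4
      _ = _ := by ring)
  obtain ⟨⟨σ, x, y⟩, hw, rfl⟩ := mem_image.1 hq
  obtain ⟨⟨τ, x', y'⟩, hw', rfl⟩ := mem_image.1 hz
  simp only [hD, mem_product, mem_range] at hw hw'
  simp only [hφ] at hqz
  have hs : σ * τ = 1 ∨ σ * τ = -1 := by
    have h1 := hw.1
    have h2 := hw'.1
    simp only [hS, mem_insert, mem_singleton] at h1 h2
    rcases h1 with rfl | rfl <;> rcases h2 with rfl | rfl <;> simp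
  have hqz' : σ * τ * (((g ^ (x + x') : (ZMod p)ˣ) : ZMod p) -
      ((g ^ (y + y') : (ZMod p)ˣ) : ZMod p)) = c := by
    rw [← hqz, pow_add, pow_add]
    push_cast
    ring
  rcases hs with hs | hs
  · refine ⟨x + x', y + y', by omega, by omega, ?_⟩
    rw [← hqz', hs, one_mul]
  · refine ⟨y + y', x + x', by omega, by omega, ?_⟩
    rw [← hqz', hs]
    ring

/-- For every `ε > 0` there exists `p₀` such that for every prime
`p > p₀` and every primitive root `g` modulo `p`, every element of `F_p` is of the
form `g^x − g^y` with `0 ≤ x, y < (√2 + ε)·p^{3/4}`. -/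
theorem difference_of_powers_covers (ε : ℝ) (hε : 0 < ε) :
    ∃ p₀ : ℕ, ∀ p : ℕ, p.Prime → p₀ < p →
      ∀ g : (ZMod p)ˣ, (∀ u : (ZMod p)ˣ, u ∈ Subgroup.zpowers g) →
        ∀ c : ZMod p, ∃ x y : ℕ,
          (x : ℝ) < (Real.sqrt 2 + ε) * (p : ℝ) ^ ((3 : ℝ) / 4) ∧
          (y : ℝ) < (Real.sqrt 2 + ε) * (p : ℝ) ^ ((3 : ℝ) / 4) ∧
          ((g ^ x : (ZMod p)ˣ) : ZMod p) - ((g ^ y : (ZMod p)ˣ) : ZMod p) = c := by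
  refine ⟨100, fun p hp hp100 g hg c => ?_⟩
  haveI : Fact p.Prime := ⟨hp⟩
  have hord : orderOf g = p - 1 := by
    rw [orderOf_eq_card_of_forall_mem_zpowers hg, Nat.card_eq_fintype_card, ZMod.card_units p]
  have hpR : (100 : ℝ) < p := by exact_mod_cast hp100
  have hp0 : (0 : ℝ) ≤ p := by linarith
  set s : ℝ := (p : ℝ) ^ ((1 : ℝ) / 4) with hs
  have hs0 : 0 < s := by positivity
  have hs4 : s ^ 4 = p := by
    rw [hs, ← Real.rpow_natCast, ← Real.rpow_mul hp0]
    norm_num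
  have hs3 : (p : ℝ) ^ ((3 : ℝ) / 4) = s ^ 3 := by
    rw [hs, ← Real.rpow_natCast, ← Real.rpow_mul hp0]
    norm_num
  rw [hs3]
  have hs2 : 2 ≤ s := by
    by_contra! h
    have : s ^ 4 < 2 ^ 4 := pow_lt_pow_left₀ h hs0.le (by norm_num)
    linarith
  have h2 : Real.sqrt 2 ^ 2 = 2 := Real.sq_sqrt (by norm_num)
  have h2p : 0 < Real.sqrt 2 := by positivity
  have h2u : Real.sqrt 2 < 1.5 := by
    rw [Real.sqrt_lt' (by norm_num)]
    norm_num
  have hB : Real.sqrt 2 * s ^ 3 < (Real.sqrt 2 + ε) * s ^ 3 := by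
    have : 0 < ε * s ^ 3 := by positivity
    linarith
  have hB0 : 0 < Real.sqrt 2 * s ^ 3 := by positivity
  by_cases hc : c = 0
  · refine ⟨0, 0, ?_, ?_, by simp [hc]⟩ <;> push_cast <;> linarith
  set t : ℝ := Real.sqrt 2 * s ^ 3 / 2 with ht
  have ht0 : 0 < t := by positivity
  set M : ℕ := ⌊t⌋₊ + 1 with hMdef
  have hMl : t < M := by
    rw [hMdef]
    push_cast
    exact Nat.lt_floor_add_one t
  have hMu : (M : ℝ) ≤ t + 1 := by
    rw [hMdef]
    push_cast
    linarith [Nat.floor_le ht0.le]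
  have hM : 2 * M ≤ p - 1 := by
    have h : 2 * (M : ℝ) + 1 ≤ p := by
      have a1 : s ^ 3 * 2 ≤ p := by
        rw [← hs4]
        have : 0 < s ^ 3 := by positivity
        nlinarith
      have a2 : Real.sqrt 2 * s ^ 3 ≤ 1.5 * s ^ 3 := by gcongr
      linarith
    have h' : 2 * M + 1 ≤ p := by exact_mod_cast h
    omega
  have hM4 : p ^ 3 < 4 * M ^ 4 := by
    have h : (p : ℝ) ^ 3 < 4 * (M : ℝ) ^ 4 := by
      have a1 : t ^ 4 < (M : ℝ) ^ 4 := pow_lt_pow_left₀ hMl ht0.le (by norm_num)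
      have a2 : 4 * t ^ 4 = (p : ℝ) ^ 3 := by
        rw [ht, ← hs4]
        linear_combination (s ^ 12 / 4 * (Real.sqrt 2 ^ 2 + 2)) * h2
      linarith
    exact_mod_cast h
  obtain ⟨x, y, hx, hy, hxy⟩ := cover_aux p (by omega) g hord M hM hM4 c hc
  have hx' : (x : ℝ) + 2 ≤ 2 * M := by exact_mod_cast hx
  have hy' : (y : ℝ) + 2 ≤ 2 * M := by exact_mod_cast hy
  exact ⟨x, y, by linarith, by linarith, hxy⟩
end

section
/- Let q be a prime power. For each x ∈ F_q^* let X(x) and Y(x) be subsets of F_q^*, and put T = (Σ_{x ∈ F_q^*} |X(x)|) · (Σ_{y ∈ F_q^*} |Y(y)|). Then the number S of quadruples (x, y, x′, y′) with x, y ∈ F_q^*, x′ ∈ X(x), y′ ∈ Y(y) and x·y − x′·y′ = 1 satisfies |S − T/q| ≤ 2·√(q·T). -/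
open Finset in
theorem aux_one {F : Type*} [Field F] [Fintype F] [DecidableEq F] (b : Fˣ × Fˣ) :
    ∑ a : F × F, (if a.1 * (b.1 : F) - a.2 * (b.2 : F) = 1 then (1 : ℝ) else 0)
      = Fintype.card F := by
  rw [Fintype.sum_prod_type, sum_comm]
  have h : ∀ y : F, ∑ x : F, (if x * (b.1 : F) - y * (b.2 : F) = 1 then (1 : ℝ) else 0) = 1 := by
    intro y
    rw [sum_eq_single ((1 + y * b.2) * (b.1 : F)⁻¹)]
    · have := b.1.ne_zero
      rw [if_pos]
      field_simp
      ring
    · intro x _ hx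
      rw [if_neg]
      intro h
      apply hx
      have := b.1.ne_zero
      field_simp
      linear_combination h
    · simp
  simp only [h]
  simp

open Finset in
theorem aux_two {F : Type*} [Field F] [Fintype F] [DecidableEq F] (b c : Fˣ × Fˣ) (hbc : b ≠ c) :
    ∑ a : F × F, (if a.1 * (b.1 : F) - a.2 * (b.2 : F) = 1 then (1 : ℝ) else 0)
      * (if a.1 * (c.1 : F) - a.2 * (c.2 : F) = 1 then (1 : ℝ) else 0) ≤ 1 := by
  have e : ∀ a : F × F, (if a.1 * (b.1 : F) - a.2 * (b.2 : F) = 1 then (1 : ℝ) else 0)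
      * (if a.1 * (c.1 : F) - a.2 * (c.2 : F) = 1 then (1 : ℝ) else 0)
      = if (a.1 * (b.1 : F) - a.2 * (b.2 : F) = 1 ∧ a.1 * (c.1 : F) - a.2 * (c.2 : F) = 1)
        then 1 else 0 := by
    intro a
    split_ifs <;> simp_all
  simp only [e]
  rw [sum_boole]
  norm_cast
  rw [card_le_one]
  rintro ⟨a1, a2⟩ ha ⟨d1, d2⟩ hd
  simp only [mem_filter, mem_univ, true_and] at ha hd
  obtain ⟨h1, h2⟩ := ha
  obtain ⟨h3, h4⟩ := hd
  have hdet : (b.1 : F) * c.2 - b.2 * c.1 ≠ 0 := by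
    intro h0
    have k2 : (b.2 : F) = c.2 := by linear_combination (c.2 : F) * h1 - (b.2 : F) * h2 - a1 * h0
    have k1 : (b.1 : F) = c.1 := by linear_combination (c.1 : F) * h1 - (b.1 : F) * h2 - a2 * h0
    exact hbc (Prod.ext (Units.ext k1) (Units.ext k2))
  have r1 : a1 = d1 := by
    apply mul_right_cancel₀ hdet
    linear_combination (c.2 : F) * (h1 - h3) - (b.2 : F) * (h2 - h4)
  have r2 : a2 = d2 := by
    apply mul_right_cancel₀ hdet
    linear_combination (c.1 : F) * (h1 - h3) - (b.1 : F) * (h2 - h4)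
  rw [r1, r2]

open Finset in
theorem aux_three {F : Type*} [Field F] [Fintype F] [DecidableEq F] (B : Finset (Fˣ × Fˣ)) :
    ∑ a : F × F, ((∑ b ∈ B, if a.1 * (b.1 : F) - a.2 * (b.2 : F) = 1 then (1 : ℝ) else 0)
      - #B / Fintype.card F) ^ 2 ≤ Fintype.card F * #B := by
  set I : F × F → Fˣ × Fˣ → ℝ := fun a b =>
    if a.1 * (b.1 : F) - a.2 * (b.2 : F) = 1 then (1 : ℝ) else 0 with hI
  set q : ℝ := (Fintype.card F : ℝ) with hq
  have hq0 : 0 < q := by rw [hq]; exact_mod_cast Fintype.card_pos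
  have h1 : ∀ b, ∑ a : F × F, I a b = q := fun b => aux_one b
  have m1 : ∑ a : F × F, ∑ b ∈ B, I a b = #B * q := by
    rw [sum_comm]; simp [h1]
  have m2 : ∑ a : F × F, (∑ b ∈ B, I a b) ^ 2 ≤ #B * q + #B * #B := by
    have : ∀ a, (∑ b ∈ B, I a b) ^ 2 = ∑ b ∈ B, ∑ c ∈ B, I a b * I a c := by
      intro a; rw [sq, sum_mul_sum]
    simp only [this]
    rw [sum_comm]
    have : ∀ b ∈ B, ∑ a : F × F, ∑ c ∈ B, I a b * I a c ≤ q + #B := by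
      intro b hb
      rw [sum_comm]
      calc ∑ c ∈ B, ∑ a : F × F, I a b * I a c
          ≤ ∑ c ∈ B, ((if b = c then q else 0) + 1) := by
            apply sum_le_sum
            intro c _
            split_ifs with h
            · subst h
              have : ∀ a, I a b * I a b = I a b := by intro a; simp [hI]
              simp only [this, h1]; linarith
            · rw [zero_add]; exact aux_two b c h
        _ = q + #B := by simp [sum_add_distrib, hb]
    calc _ ≤ ∑ b ∈ B, (q + #B) := sum_le_sum this
      _ = _ := by simp [mul_add]
  have ex : ∀ a, ((∑ b ∈ B, I a b) - #B / q) ^ 2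
      = (∑ b ∈ B, I a b) ^ 2 - 2 * (#B / q) * (∑ b ∈ B, I a b) + (#B / q) ^ 2 := by
    intro a; ring
  change ∑ a : F × F, ((∑ b ∈ B, I a b) - #B / q) ^ 2 ≤ _
  simp only [ex]
  rw [sum_add_distrib, sum_sub_distrib, ← mul_sum, m1]
  simp only [sum_const, card_univ, Fintype.card_prod, nsmul_eq_mul, Nat.cast_mul, ← hq]
  have e1 : 2 * ((#B : ℝ) / q) * (#B * q) = 2 * #B * #B := by field_simp
  have e2 : q * q * ((#B : ℝ) / q) ^ 2 = #B * #B := by field_simp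
  rw [e1, e2]
  linarith

open Finset in
theorem aux_four {F : Type*} [Field F] [Fintype F] [DecidableEq F] (A B : Finset (Fˣ × Fˣ)) :
    |(∑ a ∈ A, ∑ b ∈ B, if (a.1 : F) * (b.1 : F) - a.2 * (b.2 : F) = 1 then (1 : ℝ) else 0)
      - #A * #B / Fintype.card F| ≤ √(Fintype.card F * (#A * #B)) := by
  set f : F × F → ℝ := fun a =>
    (∑ b ∈ B, if a.1 * (b.1 : F) - a.2 * (b.2 : F) = 1 then (1 : ℝ) else 0)
      - #B / Fintype.card F with hf
  have e : (∑ a ∈ A, ∑ b ∈ B,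
      if (a.1 : F) * (b.1 : F) - a.2 * (b.2 : F) = 1 then (1 : ℝ) else 0)
      - #A * #B / Fintype.card F = ∑ a ∈ A, f ((a.1 : F), (a.2 : F)) := by
    simp only [hf, sum_sub_distrib, sum_const, nsmul_eq_mul]
    ring
  rw [e]
  apply Real.abs_le_sqrt
  have h2 : ∑ a ∈ A, f ((a.1 : F), (a.2 : F)) ^ 2 ≤ ∑ a : F × F, f a ^ 2 := by
    have hinj : Function.Injective (fun a : Fˣ × Fˣ => ((a.1 : F), (a.2 : F))) := by
      intro a b h
      simp only [Prod.mk.injEq] at h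
      exact Prod.ext (Units.ext h.1) (Units.ext h.2)
    refine (sum_map A ⟨_, hinj⟩ (fun a => f a ^ 2)).symm.trans_le ?_
    exact sum_le_sum_of_subset_of_nonneg (subset_univ _) (fun _ _ _ => sq_nonneg _)
  calc _ ≤ (#A : ℝ) * ∑ a ∈ A, f ((a.1 : F), (a.2 : F)) ^ 2 := sq_sum_le_card_mul_sum_sq
    _ ≤ #A * (Fintype.card F * #B) := by
      gcongr
      exact h2.trans (aux_three B)
    _ = _ := by ring


/-- Let `q` be a prime power. For each `x ∈ F_q^*` let
`X(x), Y(x) ⊆ F_q^*`, and put `T = (Σ_x |X(x)|)·(Σ_y |Y(y)|)`. Then the number `S`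
of quadruples `(x,y,x',y')` with `x, y ∈ F_q^*`, `x' ∈ X(x)`, `y' ∈ Y(y)` and
`x·y − x'·y' = 1` satisfies `|S − T/q| ≤ 2·√(q·T)`. -/
theorem solutions_product_difference_one {F : Type*} [Field F] [Fintype F]
    [DecidableEq F] (X Y : Fˣ → Finset Fˣ) :
    |((Finset.univ.filter (fun t : Fˣ × Fˣ × Fˣ × Fˣ =>
          t.2.2.1 ∈ X t.1 ∧ t.2.2.2 ∈ Y t.2.1 ∧
            (t.1 : F) * (t.2.1 : F) - (t.2.2.1 : F) * (t.2.2.2 : F) = 1)).card : ℝ)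
        - ((∑ x : Fˣ, ((X x).card : ℝ)) * (∑ y : Fˣ, ((Y y).card : ℝ)))
          / (Fintype.card F : ℝ)|
      ≤ 2 * Real.sqrt ((Fintype.card F : ℝ)
          * ((∑ x : Fˣ, ((X x).card : ℝ)) * (∑ y : Fˣ, ((Y y).card : ℝ)))) := by

  classical
  set A : Finset (Fˣ × Fˣ) := Finset.univ.filter (fun p => p.2 ∈ X p.1) with hA
  set B : Finset (Fˣ × Fˣ) := Finset.univ.filter (fun p => p.2 ∈ Y p.1) with hB
  have key : ∀ Z : Fˣ → Finset Fˣ, ∑ x : Fˣ, ((Z x).card : ℝ)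
      = ((Finset.univ.filter (fun p : Fˣ × Fˣ => p.2 ∈ Z p.1)).card : ℝ) := by
    intro Z
    rw [← Finset.sum_boole, Fintype.sum_prod_type]
    simp
  rw [key X, key Y, ← hA, ← hB]
  have hS : ((Finset.univ.filter (fun t : Fˣ × Fˣ × Fˣ × Fˣ =>
          t.2.2.1 ∈ X t.1 ∧ t.2.2.2 ∈ Y t.2.1 ∧
            (t.1 : F) * (t.2.1 : F) - (t.2.2.1 : F) * (t.2.2.2 : F) = 1)).card : ℝ)
      = ∑ a ∈ A, ∑ b ∈ B,
        if (a.1 : F) * (b.1 : F) - a.2 * (b.2 : F) = 1 then (1 : ℝ) else 0 := by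
    rw [← Finset.sum_boole, hA, hB]
    simp only [Finset.sum_filter, Fintype.sum_prod_type]
    refine Finset.sum_congr rfl fun x _ => ?_
    rw [Finset.sum_congr rfl fun y _ => rfl]
    have : ∀ y : Fˣ, ∀ x' : Fˣ, ∀ y' : Fˣ,
      (if x' ∈ X x ∧ y' ∈ Y y ∧ (x : F) * y - x' * y' = 1 then (1 : ℝ) else 0)
      = if x' ∈ X x then (if y' ∈ Y y then
          (if (x : F) * y - x' * y' = 1 then (1 : ℝ) else 0) else 0) else 0 := by
      intro y x' y'
      split_ifs <;> simp_all
    simp only [this]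
    rw [Finset.sum_comm]
    refine Finset.sum_congr rfl fun x' _ => ?_
    split_ifs <;> simp
  rw [hS]
  refine (aux_four A B).trans ?_
  have := Real.sqrt_nonneg ((Fintype.card F : ℝ) * ((A.card : ℝ) * B.card))
  linarith
end

section
/- Let p be a prime, g a primitive root modulo p, and λ ∈ F_p with λ ≠ 0. Let I and J be intervals in Z_{p−1}, i.e., sets of the form {a, a+1, …, a+N−1} reduced modulo p−1 with 0 ≤ N ≤ p−1. Then for every positive integer r, the number N(I, J) = |{(x, y) ∈ I × J : g^x − g^y = λ in F_p}| satisfies |N(I, J) − |I||J|/p| ≤ 4^r · ((|I||J|/p^{3/2})^{1/r} + 1) · √p. -/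
namespace DPD

open Finset

/-- incidence indicator -/
noncomputable def inc {p : ℕ} (lam : ZMod p) (v s : ZMod p × ZMod p) : ℝ :=
  if s.1 * v.1 - s.2 * v.2 = lam then 1 else 0

lemma sum_inc {p : ℕ} [Fact p.Prime] (lam : ZMod p) (s : ZMod p × ZMod p) (hs : s.1 ≠ 0) :
    ∑ v : ZMod p × ZMod p, inc lam v s = p := by
  rw [Fintype.sum_prod_type_right]
  have : ∀ y : ZMod p, ∑ x : ZMod p, inc lam (x, y) s = 1 := by
    intro y
    have h : ∀ x : ZMod p, inc lam (x, y) s = if x = (lam + s.2 * y) / s.1 then 1 else 0 := by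
      intro x
      unfold inc
      congr 1
      simp only [eq_iff_iff]
      rw [eq_div_iff hs]
      constructor
      · intro h; linear_combination h
      · intro h; linear_combination h
    simp [h]
  simp [this, ZMod.card]

lemma sum_inc_mul {p : ℕ} [Fact p.Prime] (lam : ZMod p) (hlam : lam ≠ 0)
    (s s' : ZMod p × ZMod p) (hs : s.1 ≠ 0) :
    ∑ v : ZMod p × ZMod p, inc lam v s * inc lam v s' ≤ 1 + if s = s' then (p : ℝ) else 0 := by
  split_ifs with h
  · subst h
    have h1 : ∀ v, inc lam v s * inc lam v s = inc lam v s := by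
      intro v; unfold inc; split_ifs <;> simp
    simp only [h1, sum_inc lam s hs]
    linarith
  · have h1 : ∀ v, inc lam v s * inc lam v s' =
        if (s.1 * v.1 - s.2 * v.2 = lam ∧ s'.1 * v.1 - s'.2 * v.2 = lam) then 1 else 0 := by
      intro v; unfold inc
      by_cases a : s.1 * v.1 - s.2 * v.2 = lam <;>
      by_cases b : s'.1 * v.1 - s'.2 * v.2 = lam <;> simp [a, b]
    simp only [h1, add_zero, Finset.sum_boole]
    norm_cast
    rw [Finset.card_le_one]
    intro v hv w hw
    simp only [mem_filter, mem_univ, true_and] at hv hw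
    obtain ⟨v1, v2⟩ := hv
    obtain ⟨w1, w2⟩ := hw
    have hdet : s.1 * s'.2 - s'.1 * s.2 ≠ 0 := by
      intro hd
      have e : (s.1 - s'.1) * lam = 0 := by
        linear_combination (-s.1) * v2 + s'.1 * v1 - v.2 * hd
      have e1 : s.1 = s'.1 := by
        rcases mul_eq_zero.1 e with e | e
        · exact sub_eq_zero.1 e
        · exact absurd e hlam
      have e2 : s.1 * (s.2 - s'.2) = 0 := by
        linear_combination -hd + s.2 * e1
      rcases mul_eq_zero.1 e2 with e | e
      · exact hs e
      · exact h (Prod.ext e1 (sub_eq_zero.1 e))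
    have a1 : (s.1 * s'.2 - s'.1 * s.2) * (v.1 - w.1) = 0 := by
      linear_combination s'.2 * v1 - s.2 * v2 - s'.2 * w1 + s.2 * w2
    have a2 : (s.1 * s'.2 - s'.1 * s.2) * (v.2 - w.2) = 0 := by
      linear_combination s'.1 * v1 - s.1 * v2 - s'.1 * w1 + s.1 * w2
    refine Prod.ext ?_ ?_
    · exact sub_eq_zero.1 ((mul_eq_zero.1 a1).resolve_left hdet)
    · exact sub_eq_zero.1 ((mul_eq_zero.1 a2).resolve_left hdet)

lemma incidence {p : ℕ} [Fact p.Prime] (lam : ZMod p) (hlam : lam ≠ 0)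
    (P S : Finset (ZMod p × ZMod p)) (hS : ∀ s ∈ S, s.1 ≠ 0) :
    |∑ v ∈ P, ∑ s ∈ S, (inc lam v s - 1 / (p : ℝ))|
      ≤ Real.sqrt p * Real.sqrt (P.card * S.card) := by
  have hp : (0 : ℝ) < p := by exact_mod_cast (Fact.out : p.Prime).pos
  set T : ZMod p × ZMod p → ℝ := fun v => ∑ s ∈ S, inc lam v s with hT
  have hT1 : ∑ v, T v = p * S.card := by
    simp only [hT]
    rw [Finset.sum_comm, Finset.sum_congr rfl (fun s hs => sum_inc lam s (hS s hs))]
    simp [mul_comm]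
  have hT2 : ∑ v, T v ^ 2 ≤ (S.card : ℝ) ^ 2 + p * S.card := by
    have : ∑ v, T v ^ 2 = ∑ s ∈ S, ∑ s' ∈ S, ∑ v, inc lam v s * inc lam v s' := by
      simp only [hT, sq, Finset.sum_mul_sum]
      rw [Finset.sum_comm]
      refine Finset.sum_congr rfl fun s _ => ?_
      rw [Finset.sum_comm]
    rw [this]
    calc _ ≤ ∑ s ∈ S, ∑ s' ∈ S, (1 + if s = s' then (p : ℝ) else 0) :=
          Finset.sum_le_sum fun s hs => Finset.sum_le_sum fun s' _ =>
            sum_inc_mul lam hlam s s' (hS s hs)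
      _ = _ := by
          simp only [Finset.sum_add_distrib, Finset.sum_ite_eq]
          simp [mul_comm, sq]
  have hin : ∀ v, ∑ s ∈ S, (inc lam v s - 1 / (p : ℝ)) = T v - S.card / p := by
    intro v
    simp [hT, Finset.sum_sub_distrib, div_eq_mul_inv]
  simp only [hin]
  have hvar : ∑ v, (T v - S.card / p) ^ 2 ≤ p * S.card := by
    have e : ∑ v, (T v - S.card / p) ^ 2 =
        ∑ v, T v ^ 2 - 2 * (S.card / p) * ∑ v, T v + p * p * (S.card / p : ℝ) ^ 2 := by
      simp only [sub_sq, Finset.sum_add_distrib, Finset.sum_sub_distrib]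
      congr 1
      · congr 1
        rw [Finset.mul_sum]
        exact Finset.sum_congr rfl fun v _ => by ring
      · simp [ZMod.card]
    rw [e, hT1]
    have : 2 * ((S.card : ℝ) / p) * (p * S.card) = 2 * (S.card : ℝ) ^ 2 := by field_simp
    rw [this]
    have : (p : ℝ) * p * ((S.card : ℝ) / p) ^ 2 = (S.card : ℝ) ^ 2 := by field_simp
    rw [this]
    linarith
  rw [← Real.sqrt_mul hp.le]
  apply Real.abs_le_sqrt
  calc (∑ v ∈ P, (T v - S.card / p)) ^ 2
      ≤ P.card * ∑ v ∈ P, (T v - S.card / p) ^ 2 := sq_sum_le_card_mul_sum_sq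
    _ ≤ P.card * (p * S.card) := by
        gcongr
        refine le_trans ?_ hvar
        exact Finset.sum_le_sum_of_subset_of_nonneg (Finset.subset_univ _)
          fun _ _ _ => sq_nonneg _
    _ = _ := by ring

/-- indicator of the curve -/
noncomputable def del {p : ℕ} (g : (ZMod p)ˣ) (lam : ZMod p) (x y : ℤ) : ℝ :=
  if ((g ^ x : (ZMod p)ˣ) : ZMod p) - ((g ^ y : (ZMod p)ˣ) : ZMod p) = lam then 1 else 0

/-- rectangle sum -/
def rect (φ : ℤ → ℤ → ℝ) (a b : ℤ) (m n : ℕ) : ℝ :=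
  ∑ i ∈ range m, ∑ j ∈ range n, φ (a + i) (b + j)

lemma rect_add_left (φ : ℤ → ℤ → ℝ) (a b : ℤ) (m m' n : ℕ) :
    rect φ a b (m + m') n = rect φ a b m n + rect φ (a + m) b m' n := by
  simp [rect, Finset.sum_range_add, add_assoc]

lemma rect_add_right (φ : ℤ → ℤ → ℝ) (a b : ℤ) (m n n' : ℕ) :
    rect φ a b m (n + n') = rect φ a b m n + rect φ a (b + n) m n' := by
  simp [rect, Finset.sum_range_add, add_assoc, Finset.sum_add_distrib]

lemma rect_nonneg (φ : ℤ → ℤ → ℝ) (h : ∀ x y, 0 ≤ φ x y) (a b : ℤ) (m n : ℕ) :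
    0 ≤ rect φ a b m n :=
  Finset.sum_nonneg fun _ _ => Finset.sum_nonneg fun _ _ => h _ _

lemma rect_sub (φ : ℤ → ℤ → ℝ) (c : ℝ) (a b : ℤ) (m n : ℕ) :
    rect (fun x y => φ x y - c) a b m n = rect φ a b m n - m * n * c := by
  simp [rect, Finset.sum_sub_distrib, mul_assoc]

lemma bilinear {p : ℕ} [Fact p.Prime] (g : (ZMod p)ˣ) (hg : orderOf g = p - 1)
    (lam : ZMod p) (hlam : lam ≠ 0) (a b : ℤ) (m n h k : ℕ) (hm : m ≤ p - 1) (hn : n ≤ p - 1)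
    (hh : h ≤ p - 1) (hk : k ≤ p - 1) :
    |∑ t ∈ range h, ∑ u ∈ range k,
        rect (fun x y => del g lam x y - 1 / (p : ℝ)) (a + t) (b + u) m n|
      ≤ Real.sqrt p * Real.sqrt ((h * k : ℝ) * (m * n)) := by
  have inj : ∀ (c : ℤ) (i j : ℕ), i < p - 1 → j < p - 1 →
      ((g ^ (c + i) : (ZMod p)ˣ) : ZMod p) = ((g ^ (c + j) : (ZMod p)ˣ) : ZMod p) → i = j := by
    intro c i j hi hj e
    have e := Units.ext e
    rw [zpow_add, zpow_add] at e
    have e := mul_left_cancel e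
    simp only [zpow_natCast] at e
    exact pow_injOn_Iio_orderOf (by simpa [hg] using hi) (by simpa [hg] using hj) e
  have injP : ∀ (c d : ℤ) (M N : ℕ), M ≤ p - 1 → N ≤ p - 1 →
      Set.InjOn (fun q : ℕ × ℕ => (((g ^ (c + q.1) : (ZMod p)ˣ) : ZMod p),
        ((g ^ (d + q.2) : (ZMod p)ˣ) : ZMod p))) (range M ×ˢ range N : Finset (ℕ × ℕ)) := by
    intro c d M N hM hN q hq q' hq' e
    simp only [coe_product, coe_range, Set.mem_prod, Set.mem_Iio] at hq hq'
    simp only [Prod.mk.injEq] at e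
    exact Prod.ext (inj c _ _ (by omega) (by omega) e.1) (inj d _ _ (by omega) (by omega) e.2)
  set P := (range h ×ˢ range k).image (fun q : ℕ × ℕ => (((g ^ (a + q.1) : (ZMod p)ˣ) : ZMod p),
        ((g ^ (b + q.2) : (ZMod p)ˣ) : ZMod p))) with hP
  set S := (range m ×ˢ range n).image (fun q : ℕ × ℕ =>
        (((g ^ ((0 : ℤ) + q.1) : (ZMod p)ˣ) : ZMod p),
        ((g ^ ((0 : ℤ) + q.2) : (ZMod p)ˣ) : ZMod p))) with hSS
  have hPc : P.card = h * k := by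
    rw [hP, Finset.card_image_of_injOn (injP _ _ _ _ hh hk)]; simp
  have hSc : S.card = m * n := by
    rw [hSS, Finset.card_image_of_injOn (injP _ _ _ _ hm hn)]; simp
  have key := incidence lam hlam P S (by
    intro s hs
    simp only [hSS, mem_image] at hs
    obtain ⟨q, _, rfl⟩ := hs
    exact Units.ne_zero _)
  rw [hPc, hSc] at key
  push_cast at key
  refine le_trans (le_of_eq ?_) key
  congr 1
  rw [hP, Finset.sum_image (injP _ _ _ _ hh hk), Finset.sum_product]
  refine Finset.sum_congr rfl fun t _ => Finset.sum_congr rfl fun u _ => ?_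
  rw [hSS, Finset.sum_image (injP _ _ _ _ hm hn), Finset.sum_product, rect]
  refine Finset.sum_congr rfl fun i _ => Finset.sum_congr rfl fun j _ => ?_
  unfold del inc
  have e1 : ∀ (c : ℤ) (i t : ℕ), ((g ^ (c + t + i) : (ZMod p)ˣ) : ZMod p) =
      ((g ^ ((0:ℤ) + i) : (ZMod p)ˣ) : ZMod p) * ((g ^ (c + t) : (ZMod p)ˣ) : ZMod p) := by
    intro c i t
    rw [← Units.val_mul, ← zpow_add]
    congr 2
    ring
  simp only [e1]

lemma cover_left (φ : ℤ → ℤ → ℝ) (h : ∀ x y, 0 ≤ φ x y) (a b : ℤ) (m n t : ℕ) (ht : t ≤ m) :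
    rect φ a b m n ≤ rect φ (a - m + t) b m n + rect φ (a + t) b m n := by
  have e : rect φ (a - m + t) b m n + rect φ (a + t) b m n = rect φ (a - m + t) b (m + m) n := by
    rw [rect_add_left]; congr 2; ring
  rw [e]
  obtain ⟨d, rfl⟩ := Nat.exists_eq_add_of_le ht
  have e2 : t + d + (t + d) = d + ((t + d) + t) := by ring
  rw [e2, rect_add_left φ _ _ d, rect_add_left φ _ _ (t + d) t]
  have e3 : a - ((t + d : ℕ) : ℤ) + t + d = a := by push_cast; ring
  rw [e3]
  have := rect_nonneg φ h (a - ((t + d : ℕ) : ℤ) + t) b d n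
  have := rect_nonneg φ h (a + (t + d : ℕ)) b t n
  linarith

lemma cover_right (φ : ℤ → ℤ → ℝ) (h : ∀ x y, 0 ≤ φ x y) (a b : ℤ) (m n t : ℕ) (ht : t ≤ n) :
    rect φ a b m n ≤ rect φ a (b - n + t) m n + rect φ a (b + t) m n := by
  have e : ∀ a b m n, rect φ a b m n = rect (fun x y => φ y x) b a n m := by
    intro a b m n; unfold rect; exact Finset.sum_comm
  simp only [e a]
  exact cover_left _ (fun x y => h y x) b a n m t ht

lemma base_upper {p : ℕ} [Fact p.Prime] (g : (ZMod p)ˣ) (hg : orderOf g = p - 1)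
    (lam : ZMod p) (hlam : lam ≠ 0) (a b : ℤ) (m n : ℕ) (hm : m ≤ p - 1) (hn : n ≤ p - 1) :
    rect (del g lam) a b m n ≤ 4 * (m * n / p) + 4 * Real.sqrt p := by
  have hpos : ∀ x y, 0 ≤ del g lam x y := by
    intro x y; unfold del; split_ifs <;> simp
  rcases Nat.eq_zero_or_pos m with rfl | hm0
  · simp [rect]
  rcases Nat.eq_zero_or_pos n with rfl | hn0
  · simp [rect]
  have hp : (0 : ℝ) < p := by exact_mod_cast (Fact.out : p.Prime).pos
  have hmn : (0 : ℝ) < (m : ℝ) * n := by positivity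
  have B : ∀ a b : ℤ, ∑ t ∈ range m, ∑ u ∈ range n, rect (del g lam) (a + t) (b + u) m n
      ≤ (m * n : ℝ) * (m * n / p + Real.sqrt p) := by
    intro a b
    have := (abs_le.1 (bilinear g hg lam hlam a b m n m n hm hn hm hn)).2
    rw [Real.sqrt_mul_self hmn.le] at this
    simp only [rect_sub, Finset.sum_sub_distrib, Finset.sum_const, card_range, nsmul_eq_mul] at this
    have e : (m * n : ℝ) * (m * n / p + Real.sqrt p) =
      (m * (n * (m * n * (1 / p))) : ℝ) + Real.sqrt p * (m * n) := by ring
    rw [e]; linarith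
  have C : ∑ t ∈ range m, ∑ u ∈ range n, rect (del g lam) a b m n ≤
      ∑ t ∈ range m, ∑ u ∈ range n, 
        ((rect (del g lam) (a - m + t) (b - n + u) m n + rect (del g lam) (a - m + t) (b + u) m n)
        + (rect (del g lam) (a + t) (b - n + u) m n + rect (del g lam) (a + t) (b + u) m n)) := by
    refine Finset.sum_le_sum fun t ht => Finset.sum_le_sum fun u hu => ?_
    have ht := (Finset.mem_range.1 ht).le
    have hu := (Finset.mem_range.1 hu).le
    have h1 := cover_left _ hpos a b m n t ht
    have h2 := cover_right _ hpos (a - m + t) b m n u hu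
    have h3 := cover_right _ hpos (a + t) b m n u hu
    linarith
  simp only [Finset.sum_add_distrib] at C
  have h1 := B (a - m) (b - n)
  have h2 := B (a - m) b
  have h3 := B a (b - n)
  have h4 := B a b
  simp only [Finset.sum_const, card_range, nsmul_eq_mul] at C
  have : (m * n : ℝ) * rect (del g lam) a b m n ≤
      (m * n : ℝ) * (4 * (m * n / p) + 4 * Real.sqrt p) := by nlinarith
  exact le_of_mul_le_mul_left this hmn

lemma shift (φ : ℤ → ℤ → ℝ) (a b : ℤ) (m n t u : ℕ) :
    rect φ a b m n = rect φ (a + t) (b + u) m n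
      + (rect φ a b t n - rect φ (a + m) b t n)
      + (rect φ (a + t) b m u - rect φ (a + t) (b + n) m u) := by
  have h1 := rect_add_left φ a b m t n
  have h2 := rect_add_left φ a b t m n
  have h3 := rect_add_right φ (a + t) b m n u
  have h4 := rect_add_right φ (a + t) b m u n
  rw [add_comm t m] at h2
  rw [add_comm u n] at h4
  linarith

lemma main {p : ℕ} [Fact p.Prime] (g : (ZMod p)ˣ) (hg : orderOf g = p - 1)
    (lam : ZMod p) (hlam : lam ≠ 0) (r : ℕ) : ∀ (a b : ℤ) (m n : ℕ), m ≤ p - 1 → n ≤ p - 1 →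
    |rect (fun x y => del g lam x y - 1 / (p : ℝ)) a b m n| ≤
      Real.sqrt p * ((4 ^ (r + 1) - 1 / 3) *
        ((m * n : ℝ) / (p : ℝ) ^ ((3 : ℝ) / 2)) ^ ((1 : ℝ) / (r + 1 : ℕ)) + 4 ^ (r + 1)) := by
  have hp : (0 : ℝ) < p := by exact_mod_cast (Fact.out : p.Prime).pos
  set q : ℝ := (p : ℝ) ^ ((3 : ℝ) / 2) with hq
  have hq0 : 0 < q := by positivity
  have hqp : Real.sqrt p * p = q := by
    rw [hq, Real.sqrt_eq_rpow, ← Real.rpow_add_one hp.ne']; norm_num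
  have hsp : 0 < Real.sqrt p := Real.sqrt_pos.2 hp
  have base : ∀ (a b : ℤ) (m n : ℕ), m ≤ p - 1 → n ≤ p - 1 →
    |rect (fun x y => del g lam x y - 1 / (p : ℝ)) a b m n| ≤
      Real.sqrt p * (3 * ((m * n : ℝ) / q) + 4) := by
    intro a b m n hm hn
    have hu := base_upper g hg lam hlam a b m n hm hn
    have hl := rect_nonneg (del g lam) (by intro x y; unfold del; split_ifs <;> simp) a b m n
    rw [rect_sub]
    have e : (m * n : ℝ) / p = Real.sqrt p * ((m * n : ℝ) / q) := by
      rw [← hqp]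
      have := Real.mul_self_sqrt hp.le
      field_simp
    have e' : (m * n : ℝ) * (1 / p) = (m * n : ℝ) / p := by ring
    rw [e']
    have h0 : 0 ≤ (m * n : ℝ) / p := by positivity
    have e2 : Real.sqrt p * (3 * ((m * n : ℝ) / q) + 4) = 3 * ((m * n : ℝ) / p) + 4 * Real.sqrt p := by
      rw [e]; ring
    rw [e2, abs_le]
    constructor <;> linarith
  induction r with
  | zero =>
    intro a b m n hm hn
    refine (base a b m n hm hn).trans ?_
    have h0 : 0 ≤ (m * n : ℝ) / q := by positivity
    simp only [zero_add, Nat.cast_one, div_one, Real.rpow_one, pow_one]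
    gcongr
    norm_num
  | succ r ih =>
    intro a b m n hm hn
    have h4 : (4 : ℝ) ≤ 4 ^ (r + 1 + 1) := by
      have : (1 : ℝ) ≤ 4 ^ (r + 1) := one_le_pow₀ (by norm_num)
      rw [pow_succ]; linarith
    set M : ℝ := (m * n : ℝ) / q with hM
    have hM0 : 0 ≤ M := by positivity
    set s : ℝ := M ^ ((1 : ℝ) / (r + 1 + 1 : ℕ)) with hs
    rcases le_or_gt M 1 with h1 | h1
    · refine (base a b m n hm hn).trans ?_
      have hMs : M ≤ s := by
        rcases hM0.eq_or_lt with h0 | h0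
        · rw [← h0]; positivity
        · have := Real.rpow_le_rpow_of_exponent_ge h0 h1
            (show (1 : ℝ) / (r + 1 + 1 : ℕ) ≤ 1 by
              rw [div_le_one (by positivity)]; push_cast; linarith [(Nat.cast_nonneg r : (0:ℝ) ≤ r)])
          rwa [Real.rpow_one] at this
      have hs0 : 0 ≤ s := hM0.trans hMs
      gcongr
      · linarith
      · linarith
    · have hs1 : 1 ≤ s := Real.one_le_rpow h1.le (by positivity)
      have hs0 : 0 < s := by linarith
      have hMs : M = s ^ (r + 1 + 1) := by
        rw [hs, ← Real.rpow_natCast, ← Real.rpow_mul hM0, one_div_mul_cancel (by positivity),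
          Real.rpow_one]
      have hm0 : 0 < m := by
        rcases Nat.eq_zero_or_pos m with rfl | h
        · simp [hM] at h1; linarith
        · exact h
      have hn0 : 0 < n := by
        rcases Nat.eq_zero_or_pos n with rfl | h
        · simp [hM] at h1; linarith
        · exact h
      have hmR : (0 : ℝ) < m := by exact_mod_cast hm0
      have hnR : (0 : ℝ) < n := by exact_mod_cast hn0
      have small : ∀ (a b : ℤ) (m' n' : ℕ), m' ≤ p - 1 → n' ≤ p - 1 → (m' * n' : ℝ) ≤ m * n / s →
          |rect (fun x y => del g lam x y - 1 / (p : ℝ)) a b m' n'| ≤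
          Real.sqrt p * ((4 ^ (r + 1) - 1 / 3) * s + 4 ^ (r + 1)) := by
        intro a b m' n' hm' hn' hle
        refine (ih a b m' n' hm' hn').trans ?_
        have h41 : (1 : ℝ) ≤ 4 ^ (r + 1) := one_le_pow₀ (by norm_num)
        have : ((m' * n' : ℝ) / q) ^ ((1 : ℝ) / (r + 1 : ℕ)) ≤ s := by
          have h5 : (m' * n' : ℝ) / q ≤ s ^ (r + 1) := by
            calc (m' * n' : ℝ) / q ≤ (m * n / s) / q := by gcongr
              _ = M / s := by rw [hM]; ring
              _ = s ^ (r + 1) := by rw [hMs, pow_succ]; field_simp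
          calc _ ≤ (s ^ (r + 1)) ^ ((1 : ℝ) / (r + 1 : ℕ)) :=
                Real.rpow_le_rpow (by positivity) h5 (by positivity)
            _ = s := by
                rw [← Real.rpow_natCast, ← Real.rpow_mul hs0.le, mul_one_div_cancel (by positivity),
                  Real.rpow_one]
        have h6 : (0 : ℝ) ≤ 4 ^ (r + 1) - 1 / 3 := by linarith
        gcongr
      set h := ⌈(m : ℝ) / s⌉₊ with hh
      set k := ⌈(n : ℝ) / s⌉₊ with hk
      have hh1 : (m : ℝ) / s ≤ h := Nat.le_ceil _
      have hk1 : (n : ℝ) / s ≤ k := Nat.le_ceil _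
      have hhm : h ≤ m := Nat.ceil_le.2 (div_le_self hmR.le hs1)
      have hkn : k ≤ n := Nat.ceil_le.2 (div_le_self hnR.le hs1)
      have hh0 : (0 : ℝ) < h := lt_of_lt_of_le (by positivity) hh1
      have hk0 : (0 : ℝ) < k := lt_of_lt_of_le (by positivity) hk1
      set φ := fun x y => del g lam x y - 1 / (p : ℝ) with hφ
      set R := Real.sqrt p * ((4 ^ (r + 1) - 1 / 3) * s + 4 ^ (r + 1)) with hR
      have hdiff : ∀ t ∈ range h, ∀ u ∈ range k,
          |rect φ a b m n - rect φ (a + t) (b + u) m n| ≤ 4 * R := by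
        intro t ht u hu
        have ht := Finset.mem_range.1 ht
        have hu := Finset.mem_range.1 hu
        have ht' : (t : ℝ) ≤ m / s := (Nat.lt_ceil.1 ht).le
        have hu' : (u : ℝ) ≤ n / s := (Nat.lt_ceil.1 hu).le
        have at1 : (t * n : ℝ) ≤ m * n / s := by
          calc (t * n : ℝ) ≤ m / s * n := by gcongr
            _ = _ := by ring
        have au1 : (m * u : ℝ) ≤ m * n / s := by
          calc (m * u : ℝ) ≤ m * (n / s) := by gcongr
            _ = _ := by ring
        have s1 := abs_le.1 (small a b t n (by omega) hn at1)
        have s2 := abs_le.1 (small (a + m) b t n (by omega) hn at1)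
        have s3 := abs_le.1 (small (a + t) b m u hm (by omega) au1)
        have s4 := abs_le.1 (small (a + t) (b + n) m u hm (by omega) au1)
        rw [shift φ a b m n t u, abs_le]
        constructor <;> linarith [s1.1, s1.2, s2.1, s2.2, s3.1, s3.2, s4.1, s4.2]
      have hsum : |∑ t ∈ range h, ∑ u ∈ range k,
          (rect φ a b m n - rect φ (a + t) (b + u) m n)| ≤ h * (k * (4 * R)) := by
        refine (Finset.abs_sum_le_sum_abs _ _).trans ?_
        refine (Finset.sum_le_card_nsmul _ _ (k * (4 * R)) fun t ht => ?_).trans (by simp)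
        refine (Finset.abs_sum_le_sum_abs _ _).trans ?_
        exact (Finset.sum_le_card_nsmul _ _ (4 * R) fun u hu => hdiff t ht u hu).trans (by simp)
      simp only [Finset.sum_sub_distrib, Finset.sum_const, card_range, nsmul_eq_mul] at hsum
      have hbil := bilinear g hg lam hlam a b m n h k hm hn (by omega) (by omega)
      have hsq : Real.sqrt ((h * k : ℝ) * (m * n)) ≤ h * k * s := by
        rw [Real.sqrt_le_left (by positivity)]
        have e1 : (m : ℝ) ≤ h * s := (div_le_iff₀ hs0).1 hh1
        have e2 : (n : ℝ) ≤ k * s := (div_le_iff₀ hs0).1 hk1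
        calc (h * k : ℝ) * (m * n) ≤ (h * k : ℝ) * ((h * s) * (k * s)) := by gcongr
          _ = _ := by ring
      have hbil2 : |∑ t ∈ range h, ∑ u ∈ range k, rect φ (a + t) (b + u) m n| ≤
          Real.sqrt p * (h * k * s) := hbil.trans (by gcongr)
      have hfin : (h * k : ℝ) * |rect φ a b m n| ≤ (h * k : ℝ) * (Real.sqrt p * s + 4 * R) := by
        rw [← abs_of_pos (show (0 : ℝ) < h * k by positivity), ← abs_mul,
          abs_of_pos (show (0 : ℝ) < h * k by positivity)]
        have f1 := abs_le.1 hsum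
        have f2 := abs_le.1 hbil2
        rw [abs_le]
        constructor <;> linarith [f1.1, f1.2, f2.1, f2.2]
      refine (le_of_mul_le_mul_left hfin (by positivity)).trans (le_of_eq ?_)
      rw [hR, pow_succ (4 : ℝ) (r + 1)]
      ring

end DPD

/-- Let `p` be a prime, `g` a primitive root modulo `p`, `λ ≠ 0` in
`F_p`, and `I, J` intervals in `Z_{p−1}`. Then for every positive integer `r`,
`N(I,J) = |{(x,y) ∈ I × J : g^x − g^y = λ}|` satisfies
`|N(I,J) − |I||J|/p| ≤ 4^r·((|I||J|/p^{3/2})^{1/r} + 1)·√p`. -/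
theorem distribution_power_differences {p : ℕ} (hp : p.Prime)
    (g : (ZMod p)ˣ) (hg : ∀ u : (ZMod p)ˣ, u ∈ Subgroup.zpowers g)
    (lam : ZMod p) (hlam : lam ≠ 0)
    (I J : Finset (ZMod (p - 1)))
    (hI : ∃ (a : ZMod (p - 1)) (N : ℕ), N ≤ p - 1 ∧
      I = (Finset.range N).image (fun k : ℕ => a + (k : ZMod (p - 1))))
    (hJ : ∃ (a : ZMod (p - 1)) (N : ℕ), N ≤ p - 1 ∧
      J = (Finset.range N).image (fun k : ℕ => a + (k : ZMod (p - 1))))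
    (r : ℕ) (hr : 0 < r) :
    |(((I ×ˢ J).filter (fun t : ZMod (p - 1) × ZMod (p - 1) =>
          ((g ^ t.1.val : (ZMod p)ˣ) : ZMod p)
            - ((g ^ t.2.val : (ZMod p)ˣ) : ZMod p) = lam)).card : ℝ)
        - (I.card : ℝ) * J.card / (p : ℝ)|
      ≤ 4 ^ r * (((I.card : ℝ) * J.card / (p : ℝ) ^ ((3 : ℝ) / 2)) ^ ((1 : ℝ) / r) + 1)
          * Real.sqrt p := by
  have : Fact p.Prime := ⟨hp⟩
  have : NeZero (p - 1) := ⟨by have := hp.two_le; omega⟩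
  have hord : orderOf g = p - 1 := by
    rw [orderOf_eq_card_of_forall_mem_zpowers hg, Nat.card_eq_fintype_card, ZMod.card_units]
  obtain ⟨a, m, hm, rfl⟩ := hI
  obtain ⟨b, n, hn, rfl⟩ := hJ
  obtain ⟨r, rfl⟩ : ∃ r', r = r' + 1 := ⟨r - 1, by omega⟩
  have inj : ∀ (a : ZMod (p - 1)) (N : ℕ), N ≤ p - 1 →
      Set.InjOn (fun k : ℕ => a + (k : ZMod (p - 1))) (Finset.range N : Finset ℕ) := by
    intro a N hN i hi j hj e
    simp only [Finset.coe_range, Set.mem_Iio] at hi hj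
    have e : (i : ZMod (p - 1)) = j := add_left_cancel e
    have e := congrArg ZMod.val e
    rwa [ZMod.val_natCast_of_lt (by omega), ZMod.val_natCast_of_lt (by omega)] at e
  have hpow : ∀ (a : ZMod (p - 1)) (k : ℕ),
      g ^ (a + (k : ZMod (p - 1))).val = g ^ ((a.val : ℤ) + k) := by
    intro a k
    rw [← Nat.cast_add, zpow_natCast, pow_inj_mod, hord, ZMod.val_add, ZMod.val_natCast]
    simp
  have key := DPD.main g hord lam hlam r a.val b.val m n hm hn
  rw [DPD.rect_sub] at key
  rw [Finset.card_image_of_injOn (inj a m hm), Finset.card_image_of_injOn (inj b n hn)]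
  simp only [Finset.card_range]
  have hcard : (((((Finset.range m).image (fun k : ℕ => a + (k : ZMod (p - 1)))) ×ˢ
      ((Finset.range n).image (fun k : ℕ => b + (k : ZMod (p - 1))))).filter
        (fun t : ZMod (p - 1) × ZMod (p - 1) =>
          ((g ^ t.1.val : (ZMod p)ˣ) : ZMod p)
            - ((g ^ t.2.val : (ZMod p)ˣ) : ZMod p) = lam)).card : ℝ)
      = DPD.rect (DPD.del g lam) a.val b.val m n := by
    rw [← Finset.sum_boole, Finset.sum_product, Finset.sum_image (inj a m hm), DPD.rect]
    refine Finset.sum_congr rfl fun i _ => ?_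
    rw [Finset.sum_image (inj b n hn)]
    refine Finset.sum_congr rfl fun j _ => ?_
    simp only [hpow, DPD.del]
  rw [hcard, div_eq_mul_one_div]
  refine key.trans ?_
  rw [mul_comm]
  have h0 : 0 ≤ ((m * n : ℝ) / (p : ℝ) ^ ((3 : ℝ) / 2)) ^ ((1 : ℝ) / (r + 1 : ℕ)) := by positivity
  gcongr
  linarith
end
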